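/- For every function f in the Korenblum class A^{-∞}, the set D_−(f) has Lebesgue measure zero. -/

import Mathlib

open Filter MeasureTheory

noncomputable section

/-- The Korenblum class `A^{-∞}`: `f` analytic on the unit disc with
`|f(z)| ≤ C (1-|z|)^{-k}` for some constants `C, k > 0`. -/
def Korenblum (f : ℂ → ℂ) : Prop :=
  DifferentiableOn ℂ f (Metric.ball 0 1) ∧
    ∃ C k : ℝ, 0 < C ∧ 0 < k ∧ ∀ z ∈ Metric.ball (0:ℂ) 1, ‖f z‖ ≤ C / (1 - ‖z‖) ^ k

/-- `D_-(f)`: the set of `θ ∈ [0, 2π)` such that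
`limsup_{r→1⁻} log|f(re^{iθ})| / |log(1-r)| < 0`. -/
def Dminus (f : ℂ → ℂ) : Set ℝ :=
  {θ | θ ∈ Set.Ico 0 (2 * Real.pi) ∧
    ∃ c : ℝ, 0 < c ∧ ∀ᶠ r : ℝ in nhdsWithin 1 (Set.Iio 1),
      Real.log ‖f ((r : ℂ) * Complex.exp (Complex.I * (θ : ℂ)))‖ / |Real.log (1 - r)| ≤ -c}

section

open Metric Set Topology

theorem log_norm_sub_le_circleAverage_poissonKernel {R : ℝ} {w u : ℂ} (hu : u ∈ closedBall 0 R)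
    (hw : w ∈ ball 0 R) (hwu : w ≠ u) :
    Real.log ‖w - u‖
      ≤ Real.circleAverage (fun z ↦ poissonKernel 0 w z * Real.log ‖z - u‖) 0 R := by
  have hR : 0 < R := pos_of_mem_ball hw
  rw [mem_closedBall_zero_iff] at hu
  rcases hu.eq_or_lt with hu | hu
  · rw [poissonKernel_eq_re_herglotzRieszKernel]
    exact (circleAverage_re_herglotzRieszKernel_mul_log₀ (by simpa using hu) hw).ge
  · have hwR : ‖w‖ < R := by simpa using hw
    set q : ℂ → ℂ := fun z ↦ (R ^ 2 - (starRingEnd ℂ) u * z) / R with hq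
    have hR' : (R : ℂ) ≠ 0 := by exact_mod_cast hR.ne'
    have hq0 : ∀ z ∈ closedBall (0 : ℂ) R, q z ≠ 0 := by
      intro z hz h
      rw [mem_closedBall_zero_iff] at hz
      have h1 : (R : ℂ) ^ 2 = (starRingEnd ℂ) u * z := by
        simpa [hq, hR', sub_eq_zero] using h
      have h2 : R ^ 2 = ‖u‖ * ‖z‖ := by
        simpa [abs_of_pos hR] using congrArg norm h1
      nlinarith [norm_nonneg z, norm_nonneg u]
    have hsq : ∀ z : ℂ, ‖q z‖ ^ 2 * R ^ 2 - ‖z - u‖ ^ 2 * R ^ 2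
        = (R ^ 2 - ‖z‖ ^ 2) * (R ^ 2 - ‖u‖ ^ 2) := by
      intro z
      have : ‖q z‖ ^ 2 * R ^ 2 = ‖(R : ℂ) ^ 2 - (starRingEnd ℂ) u * z‖ ^ 2 := by
        simp only [hq, norm_div, Complex.norm_real, Real.norm_eq_abs, abs_of_pos hR]
        field_simp
      rw [this]
      simp only [← Complex.normSq_eq_norm_sq, Complex.normSq_apply, ← Complex.ofReal_pow,
        Complex.sub_re, Complex.sub_im, Complex.mul_re, Complex.mul_im, Complex.conj_re,
        Complex.conj_im, Complex.ofReal_re, Complex.ofReal_im]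
      ring
    have hharm : InnerProductSpace.HarmonicOnNhd (fun z ↦ Real.log ‖q z‖) (closedBall 0 R) :=
      fun z hz ↦ AnalyticAt.harmonicAt_log_norm (by fun_prop) (hq0 z hz)
    have h1 : Real.circleAverage (fun z ↦ poissonKernel 0 w z * Real.log ‖z - u‖) 0 R
        = Real.log ‖q w‖ := by
      rw [← hharm.circleAverage_poissonKernel_smul hw]
      apply Real.circleAverage_congr_sphere
      intro z hz
      rw [abs_of_pos hR, mem_sphere_zero_iff_norm] at hz
      have h := hsq z
      rw [hz, sub_self, zero_mul, sub_eq_zero, mul_left_inj' (by positivity)] at h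
      rw [pow_left_inj₀ (norm_nonneg _) (norm_nonneg _) two_ne_zero] at h
      simp [h]
    rw [h1]
    apply Real.log_le_log (norm_pos_iff.2 (sub_ne_zero.2 hwu))
    rw [← pow_le_pow_iff_left₀ (norm_nonneg _) (norm_nonneg _) two_ne_zero]
    have h := hsq w
    have h2 : 0 ≤ (R ^ 2 - ‖w‖ ^ 2) * (R ^ 2 - ‖u‖ ^ 2) := by
      apply mul_nonneg <;> nlinarith [norm_nonneg w, norm_nonneg u]
    have h3 : 0 < R ^ 2 := by positivity
    nlinarith

theorem continuousOn_poissonKernel_sphere {R : ℝ} {c w : ℂ} (hw : w ∈ ball c R) :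
    ContinuousOn (poissonKernel c w) (sphere c |R|) := by
  rw [poissonKernel_eq_re_herglotzRieszKernel]
  exact Complex.continuous_re.comp_continuousOn (continuousOn_herglotzRieszKernel_sphere hw)

/-- The **Poisson–Jensen inequality**. -/
theorem log_norm_le_circleAverage_poissonKernel {R : ℝ} {w : ℂ} {f : ℂ → ℂ}
    (hf : AnalyticOnNhd ℂ f (closedBall 0 R)) (hw : w ∈ ball 0 R) (hfw : f w ≠ 0) :
    Real.log ‖f w‖ ≤ Real.circleAverage (fun z ↦ poissonKernel 0 w z * Real.log ‖f z‖) 0 R := by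
  have hR : 0 < R := pos_of_mem_ball hw
  have hwc := ball_subset_closedBall hw
  have hm := hf.meromorphicOn
  have hord : ∀ u : closedBall (0 : ℂ) R, meromorphicOrderAt f u ≠ ⊤ := by
    rw [← hm.exists_meromorphicOrderAt_ne_top_iff_forall
      ⟨nonempty_closedBall.mpr hR.le, (convex_closedBall 0 R).isPreconnected⟩]
    refine ⟨⟨w, hwc⟩, ?_⟩
    simp [(hf w hwc).meromorphicOrderAt_eq, (hf w hwc).analyticOrderAt_eq_zero.mpr hfw]
  set D := MeromorphicOn.divisor f (closedBall 0 R) with hD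
  have hfin := D.finiteSupport (isCompact_closedBall 0 R)
  obtain ⟨g, h₁g, h₂g, h₃g⟩ := hm.extract_zeros_poles hord hfin
  have hDw : D w = 0 := by
    rw [hD, MeromorphicOn.AnalyticOnNhd.divisor_apply hf hwc,
      (hf w hwc).analyticOrderAt_eq_zero.mpr hfw]
    simp
  have hsum (F : ℂ → ℝ) : ∑ᶠ u, D u * F u = ∑ u ∈ hfin.toFinset, D u * F u := by
    rw [finsum_eq_sum_of_support_subset]
    intro u
    contrapose
    aesop
  have hsum' : ∑ᶠ u, (D u * Real.log ‖· - u‖ : ℂ → ℝ)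
      = ∑ u ∈ hfin.toFinset, (D u * Real.log ‖· - u‖ : ℂ → ℝ) := by
    rw [finsum_eq_sum_of_support_subset]
    intro u
    contrapose
    aesop
  have hacc : AccPt w (𝓟 (closedBall 0 R)) := by
    apply accPt_iff_frequently_nhdsNE.mpr
    apply compl_notMem
    exact mem_nhdsWithin.mpr ⟨ball 0 R, isOpen_ball, hw, by
      simpa using! fun _ ⟨h, _⟩ ↦ ball_subset_closedBall h⟩
  have hval : Real.log ‖f w‖ = ∑ u ∈ hfin.toFinset, D u * Real.log ‖w - u‖ + Real.log ‖g w‖ := by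
    have := MeromorphicOn.log_norm_meromorphicTrailingCoeffAt_extract_zeros_poles hfin hwc hacc
      (hm w hwc) (h₁g w hwc) (h₂g ⟨w, hwc⟩) h₃g
    rwa [(hf w hwc).meromorphicTrailingCoeffAt_of_ne_zero hfw, hsum] at this
  have hcod := MeromorphicOn.extract_zeros_poles_log h₂g h₃g
  rw [hsum'] at hcod
  have hP := continuousOn_poissonKernel_sphere hw
  have hgharm : InnerProductSpace.HarmonicOnNhd (fun z ↦ Real.log ‖g z‖) (closedBall 0 R) :=
    fun z hz ↦ (h₁g z hz).harmonicAt_log_norm (h₂g ⟨z, hz⟩)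
  have hcong : Real.circleAverage (fun z ↦ poissonKernel 0 w z * Real.log ‖f z‖) 0 R
      = Real.circleAverage ((∑ u ∈ hfin.toFinset,
          fun z ↦ (D u : ℝ) • (poissonKernel 0 w z * Real.log ‖z - u‖))
          + poissonKernel 0 w • fun z ↦ Real.log ‖g z‖) 0 R := by
    apply Real.circleAverage_congr_codiscreteWithin _ hR.ne'
    apply (hcod.filter_mono
      (codiscreteWithin_mono (by simpa [abs_of_pos hR] using sphere_subset_closedBall))).mono
    intro z hz
    simp only [hz, Pi.add_apply, Finset.sum_apply, smul_eq_mul, mul_add,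
      Finset.mul_sum]
    congr 1
    refine Finset.sum_congr rfl fun u _ ↦ ?_
    exact mul_left_comm _ _ _
  have hint (u : ℂ) :
      CircleIntegrable (fun z ↦ poissonKernel 0 w z * Real.log ‖z - u‖) 0 R :=
    (circleIntegrable_log_norm_sub_const R).continuousOn_smul hP
  have hint' (u : ℂ) :
      CircleIntegrable (fun z ↦ (D u : ℝ) • (poissonKernel 0 w z * Real.log ‖z - u‖)) 0 R :=
    (hint u).const_smul
  have hintg : CircleIntegrable (poissonKernel 0 w • fun z ↦ Real.log ‖g z‖) 0 R :=
    CircleIntegrable.continuousOn_smul (MeromorphicOn.circleIntegrable_log_norm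
      ((h₁g.mono (by simpa [abs_of_pos hR] using sphere_subset_closedBall)).meromorphicOn)) hP
  rw [hcong, Real.circleAverage_add (CircleIntegrable.sum _ fun u _ ↦ hint' u) hintg,
    hgharm.circleAverage_poissonKernel_smul hw, Real.circleAverage_sum fun u _ ↦ hint' u, hval]
  gcongr with u hu
  rw [Real.circleAverage_fun_smul, smul_eq_mul]
  have hDu : D u ≠ 0 := by simpa using hu
  apply mul_le_mul_of_nonneg_left
  · apply log_norm_sub_le_circleAverage_poissonKernel _ hw
    · rintro rfl
      exact hDu hDw
    · exact D.supportWithinDomain hDu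
  · exact_mod_cast MeromorphicOn.AnalyticOnNhd.divisor_nonneg hf u

theorem norm_sq_circleMap_sub_circleMap (ρ θ x : ℝ) :
    ‖circleMap 0 1 (x + θ) - circleMap 0 ρ θ‖ ^ 2 = 1 + ρ ^ 2 - 2 * ρ * Real.cos x := by
  have h : circleMap 0 1 (x + θ) - circleMap 0 ρ θ
      = (circleMap 0 1 x - ρ) * circleMap 0 1 θ := by
    simp only [circleMap, zero_add, Complex.ofReal_add, add_mul, Complex.exp_add,
      Complex.ofReal_one]
    ring
  rw [h, norm_mul, norm_circleMap_zero, abs_one, mul_one, ← Complex.normSq_eq_norm_sq,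
    Complex.normSq_apply]
  simp only [circleMap, zero_add, Complex.ofReal_one, one_mul, Complex.sub_re, Complex.sub_im,
    Complex.exp_ofReal_mul_I_re, Complex.exp_ofReal_mul_I_im, Complex.ofReal_re, Complex.ofReal_im]
  linear_combination Real.sin_sq_add_cos_sq x

theorem poissonKernel_circleMap_le {s θ x : ℝ} (hs : 0 < s) (hs' : s ≤ 1 / 2)
    (hx : |x| ≤ Real.pi) :
    poissonKernel 0 (circleMap 0 (1 - s) θ) (circleMap 0 1 (x + θ))
      ≤ 10 * (s / (s ^ 2 + x ^ 2)) := by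
  have hcos := Real.cos_le_one_sub_mul_cos_sq hx
  have hpi : Real.pi ^ 2 ≤ 10 := by nlinarith [Real.pi_lt_d2, Real.pi_pos]
  have hpi' : 1 / 10 ≤ 1 / Real.pi ^ 2 := one_div_le_one_div_of_le (by positivity) hpi
  have hx2 : x ^ 2 / 5 ≤ 2 / Real.pi ^ 2 * x ^ 2 := by
    have := mul_le_mul_of_nonneg_right hpi' (sq_nonneg x)
    calc x ^ 2 / 5 = 2 * (1 / 10 * x ^ 2) := by ring
      _ ≤ 2 * (1 / Real.pi ^ 2 * x ^ 2) := by gcongr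
      _ = _ := by ring
  have hden : (s ^ 2 + x ^ 2) / 5 ≤ 1 + (1 - s) ^ 2 - 2 * (1 - s) * Real.cos x := by
    have h1 : x ^ 2 / 5 ≤ 1 - Real.cos x := by linarith
    have h2 : x ^ 2 / 5 ≤ 2 * (1 - s) * (1 - Real.cos x) := by
      nlinarith [Real.cos_le_one x]
    nlinarith [sq_nonneg s]
  have hpos : 0 < s ^ 2 + x ^ 2 := by positivity
  simp only [poissonKernel, sub_zero, norm_sq_circleMap_sub_circleMap, norm_circleMap_zero, sq_abs,
    abs_one]
  calc _ ≤ (2 * s) / ((s ^ 2 + x ^ 2) / 5) := by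
        gcongr
        nlinarith
    _ = _ := by field_simp; norm_num

theorem integrable_div_sq_add_sq (s : ℝ) : Integrable fun x : ℝ ↦ s / (s ^ 2 + x ^ 2) := by
  rcases eq_or_ne s 0 with rfl | hs
  · simp
  refine ((integrable_inv_one_add_sq.comp_div hs).const_mul s⁻¹).congr (.of_forall fun x ↦ ?_)
  field_simp

theorem setIntegral_Ioi_div_sq_add_sq_le {s A : ℝ} (hs : 0 < s) (hA : 0 < A) :
    ∫ x in Ioi (A * s), s / (s ^ 2 + x ^ 2) ≤ 1 / A := by
  have hAs : 0 < A * s := by positivity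
  calc _ ≤ ∫ x in Ioi (A * s), s * x ^ (-2 : ℝ) := by
        refine setIntegral_mono_on (integrable_div_sq_add_sq s).integrableOn
          ((integrableOn_Ioi_rpow_of_lt (by norm_num) hAs).const_mul s) measurableSet_Ioi ?_
        intro x hx
        have hx0 : 0 < x := hAs.trans hx
        rw [Real.rpow_neg hx0.le, Real.rpow_two, ← div_eq_mul_inv]
        gcongr
        nlinarith
    _ = 1 / A := by
        rw [integral_const_mul, integral_Ioi_rpow_of_lt (by norm_num) hAs]
        norm_num
        rw [Real.rpow_neg_one]
        field_simp

theorem setIntegral_div_sq_add_sq_le {s A : ℝ} (hs : 0 < s) (hA : 0 < A) {S : Set ℝ}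
    (hS : MeasurableSet S) :
    ∫ x in S, s / (s ^ 2 + x ^ 2)
      ≤ s⁻¹ * volume.real (S ∩ closedBall 0 (A * s)) + 2 / A := by
  have hint := integrable_div_sq_add_sq s
  have hAs : 0 < A * s := by positivity
  have hnn : ∀ x : ℝ, 0 ≤ s / (s ^ 2 + x ^ 2) := fun x ↦ by positivity
  rw [← integral_inter_add_sdiff (t := closedBall 0 (A * s)) measurableSet_closedBall
    hint.integrableOn]
  gcongr ?_ + ?_
  · calc _ ≤ ∫ x in S ∩ closedBall 0 (A * s), s⁻¹ := by
          refine setIntegral_mono_on hint.integrableOn ?_ (hS.inter measurableSet_closedBall) ?_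
          · exact integrableOn_const
              (measure_ne_top_of_subset inter_subset_right measure_closedBall_lt_top.ne)
          · intro x _
            rw [div_le_iff₀ (by positivity)]
            field_simp
            nlinarith [sq_nonneg x]
      _ = _ := by simp [mul_comm]
  · calc _ ≤ ∫ x in Iio (-(A * s)) ∪ Ioi (A * s), s / (s ^ 2 + x ^ 2) := by
          refine setIntegral_mono_set hint.integrableOn (.of_forall hnn) (.of_forall ?_)
          rintro x ⟨_, hx⟩
          rw [mem_closedBall_zero_iff, Real.norm_eq_abs, not_le, lt_abs] at hx
          rcases hx with hx | hx
          · exact .inr hx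
          · exact .inl (by simp only [mem_Iio]; linarith)
      _ = 2 * ∫ x in Ioi (A * s), s / (s ^ 2 + x ^ 2) := by
          rw [setIntegral_union _ measurableSet_Ioi hint.integrableOn hint.integrableOn, two_mul,
            ← integral_Iic_eq_integral_Iio, ← integral_comp_neg_Ioi]
          · simp
          · rw [disjoint_left]
            intro x hx hx'
            simp only [mem_Iio, mem_Ioi] at hx hx'
            linarith
      _ ≤ _ := by
          have := setIntegral_Ioi_div_sq_add_sq_le hs hA
          calc _ ≤ 2 * (1 / A) := by gcongr
            _ = _ := by ring

theorem poissonKernel_nonneg {w z : ℂ} {c : ℂ} (h : ‖w - c‖ ≤ ‖z - c‖) :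
    0 ≤ poissonKernel c w z :=
  div_nonneg (by have := norm_nonneg (w - c); nlinarith) (sq_nonneg _)

theorem eventually_measureReal_inter_closedBall_le {E : Set ℝ} {θ : ℝ}
    (hE : Tendsto (fun t ↦ volume (E ∩ closedBall θ t) / volume (closedBall θ t)) (𝓝[>] 0) (𝓝 1))
    {ε : ℝ} (hε : 0 < ε) :
    ∀ᶠ t in 𝓝[>] 0, ∀ S : Set ℝ, MeasurableSet S → Disjoint E S →
      volume.real ((· + θ) ⁻¹' S ∩ closedBall 0 t) ≤ 2 * t * ε := by
  have hlt : ENNReal.ofReal (1 - ε) < 1 := by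
    rw [ENNReal.ofReal_lt_one]
    linarith
  filter_upwards [hE.eventually (lt_mem_nhds hlt), self_mem_nhdsWithin]
    with t ht (ht0 : 0 < t) S hS hES
  have hpre : (· + θ) ⁻¹' S ∩ closedBall 0 t = (· + θ) ⁻¹' (S ∩ closedBall θ t) := by
    ext x
    simp [dist_eq_norm]
  have hfin : volume (closedBall θ t) ≠ ⊤ := measure_closedBall_lt_top.ne
  rw [hpre, measureReal_def, measure_preimage_add_right, ← measureReal_def]
  have hsub : E ∩ closedBall θ t ⊆ closedBall θ t \ S := fun x hx ↦
    ⟨hx.2, hES.notMem_of_mem_left hx.1⟩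
  have h1 : (1 - ε) * (2 * t) ≤ volume.real (closedBall θ t \ S) := by
    have h := (ENNReal.lt_div_iff_mul_lt (.inl (by simpa using ht0)) (.inl hfin)).1 ht
    have h2 := ENNReal.toReal_mono
      (measure_ne_top_of_subset sdiff_subset hfin) (h.le.trans (measure_mono hsub))
    rw [ENNReal.toReal_mul, Real.volume_closedBall, ENNReal.toReal_ofReal',
      ENNReal.toReal_ofReal (show (0 : ℝ) ≤ 2 * t by positivity)] at h2
    exact (mul_le_mul_of_nonneg_right (le_max_left _ _) (by positivity)).trans h2
  have h3 := measureReal_sdiff_add_inter (μ := volume) (s := closedBall θ t) hS hfin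
  rw [inter_comm] at h3
  have h4 : volume.real (closedBall θ t) = 2 * t := by
    rw [measureReal_def, Real.volume_closedBall, ENNReal.toReal_ofReal (by positivity)]
  linarith

theorem circleAverage_indicator_poissonKernel_le {s A θ : ℝ} (hs : 0 < s) (hs' : s ≤ 1 / 2)
    (hA : 0 < A) {S : Set ℂ} (hS : MeasurableSet (circleMap 0 1 ⁻¹' S)) :
    Real.circleAverage (S.indicator (poissonKernel 0 (circleMap 0 (1 - s) θ))) 0 1
      ≤ 2 * (s⁻¹ * volume.real ((· + θ) ⁻¹' (circleMap 0 1 ⁻¹' S) ∩ closedBall 0 (A * s))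
        + 2 / A) := by
  set P := poissonKernel 0 (circleMap 0 (1 - s) θ)
  set S' : Set ℝ := (· + θ) ⁻¹' (circleMap 0 1 ⁻¹' S)
  have hS' : MeasurableSet S' := hS.preimage (measurable_add_const θ)
  have hpi := Real.pi_pos
  have hshift : Real.circleAverage (S.indicator P) 0 1
      = (2 * Real.pi)⁻¹ * ∫ x in Ioc (-Real.pi) Real.pi, S.indicator P (circleMap 0 1 (x + θ)) := by
    rw [Real.circleAverage_eq_integral_add (θ - Real.pi), smul_eq_mul,
      ← intervalIntegral.integral_of_le (by linarith)]
    have := intervalIntegral.integral_comp_sub_right (a := 0) (b := 2 * Real.pi)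
      (fun x ↦ S.indicator P (circleMap 0 1 (x + θ))) Real.pi
    rw [zero_sub, show 2 * Real.pi - Real.pi = Real.pi by ring] at this
    rw [← this]
    refine congrArg _ (intervalIntegral.integral_congr fun x _ ↦ ?_)
    rw [show x + (θ - Real.pi) = x - Real.pi + θ by ring]
  have hle : ∫ x in Ioc (-Real.pi) Real.pi, S.indicator P (circleMap 0 1 (x + θ))
      ≤ 10 * ∫ x in S', s / (s ^ 2 + x ^ 2) := by
    have hint := ((integrable_div_sq_add_sq s).indicator hS').const_mul 10
    rw [← integral_indicator hS', ← integral_const_mul]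
    calc _ ≤ ∫ x in Ioc (-Real.pi) Real.pi,
          10 * S'.indicator (fun x ↦ s / (s ^ 2 + x ^ 2)) x := by
          refine integral_mono_of_nonneg (.of_forall fun x ↦ ?_) hint.integrableOn ?_
          · refine indicator_apply_nonneg fun _ ↦ poissonKernel_nonneg ?_
            simp only [sub_zero, norm_circleMap_zero, abs_one]
            rw [abs_of_nonneg (by linarith)]
            linarith
          · filter_upwards [ae_restrict_mem measurableSet_Ioc] with x hx
            by_cases hxS : circleMap 0 1 (x + θ) ∈ S
            · rw [indicator_of_mem hxS, indicator_of_mem (show x ∈ S' from hxS)]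
              exact poissonKernel_circleMap_le hs hs' (abs_le.2 ⟨hx.1.le, hx.2⟩)
            · rw [indicator_of_notMem hxS, indicator_of_notMem (show x ∉ S' from hxS), mul_zero]
      _ ≤ _ := by
          refine setIntegral_le_integral hint (.of_forall fun x ↦ ?_)
          exact mul_nonneg (by norm_num) (indicator_nonneg (fun y _ ↦ by positivity) x)
  have hS0 : 0 ≤ ∫ x in S', s / (s ^ 2 + x ^ 2) :=
    integral_nonneg fun x ↦ by positivity
  rw [hshift]
  calc _ ≤ (2 * Real.pi)⁻¹ * (10 * ∫ x in S', s / (s ^ 2 + x ^ 2)) := by gcongr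
    _ ≤ 2 * ∫ x in S', s / (s ^ 2 + x ^ 2) := by
        rw [inv_mul_le_iff₀ (by positivity)]
        nlinarith [Real.pi_gt_three]
    _ ≤ _ := by
        gcongr
        exact setIntegral_div_sq_add_sq_le hs hA hS'

theorem eventually_circleAverage_indicator_poissonKernel_le {E : Set ℝ} {θ : ℝ}
    (hE : Tendsto (fun t ↦ volume (E ∩ closedBall θ t) / volume (closedBall θ t)) (𝓝[>] 0) (𝓝 1))
    {η : ℝ} (hη : 0 < η) :
    ∀ᶠ s in 𝓝[>] 0, ∀ S : Set ℂ, MeasurableSet (circleMap 0 1 ⁻¹' S) →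
      Disjoint E (circleMap 0 1 ⁻¹' S) →
      Real.circleAverage (S.indicator (poissonKernel 0 (circleMap 0 (1 - s) θ))) 0 1 ≤ η := by
  have hA : 0 < 8 / η := by positivity
  have hscale : Tendsto (fun s ↦ 8 / η * s) (𝓝[>] 0) (𝓝[>] 0) := by
    refine tendsto_nhdsWithin_iff.2 ⟨?_, ?_⟩
    · exact (Continuous.tendsto' (by fun_prop) 0 0 (by simp)).mono_left nhdsWithin_le_nhds
    · filter_upwards [self_mem_nhdsWithin] with s (hs : 0 < s)
      exact mul_pos hA hs
  filter_upwards [hscale.eventually (eventually_measureReal_inter_closedBall_le hE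
    (show 0 < η ^ 2 / 64 by positivity)), self_mem_nhdsWithin,
    nhdsWithin_le_nhds (Iic_mem_nhds (show (0 : ℝ) < 1 / 2 by norm_num))]
    with s hs (hs0 : 0 < s) hs2 S hS hES
  calc _ ≤ _ := circleAverage_indicator_poissonKernel_le hs0 hs2 hA hS
    _ ≤ 2 * (s⁻¹ * (2 * (8 / η * s) * (η ^ 2 / 64)) + 2 / (8 / η)) := by
        gcongr
        exact hs _ hS hES
    _ = η := by
        field_simp
        norm_num

theorem circleAverage_poissonKernel_mul_le {w : ℂ} {u : ℂ → ℝ} {a b η : ℝ} (hw : w ∈ ball 0 1)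
    (hu : CircleIntegrable u 0 1) (hmeas : MeasurableSet (circleMap 0 1 ⁻¹' {z | a < u z}))
    (hab : a ≤ b) (hb : ∀ z ∈ sphere 0 1, u z ≤ b)
    (hη : Real.circleAverage ({z | a < u z}.indicator (poissonKernel 0 w)) 0 1 ≤ η) :
    Real.circleAverage (fun z ↦ poissonKernel 0 w z * u z) 0 1 ≤ a + (b - a) * η := by
  have hP := continuousOn_poissonKernel_sphere hw
  have hPint : CircleIntegrable (poissonKernel 0 w) 0 1 := by
    simpa using ContinuousOn.circleIntegrable' hP
  have hP1 : Real.circleAverage (poissonKernel 0 w) 0 1 = 1 := by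
    have h : InnerProductSpace.HarmonicOnNhd (fun _ : ℂ ↦ (1 : ℝ)) (closedBall 0 1) :=
      fun z _ ↦ InnerProductSpace.harmonicAt_const 1
    have := h.circleAverage_poissonKernel_smul hw
    rwa [show poissonKernel 0 w • (fun _ : ℂ ↦ (1 : ℝ)) = poissonKernel 0 w by ext; simp] at this
  have hPS : CircleIntegrable ({z | a < u z}.indicator (poissonKernel 0 w)) 0 1 := by
    rw [CircleIntegrable, intervalIntegrable_iff] at hPint ⊢
    exact hPint.indicator hmeas
  calc _ ≤ Real.circleAverage (a • poissonKernel 0 w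
          + (b - a) • {z | a < u z}.indicator (poissonKernel 0 w)) 0 1 := by
        refine Real.circleAverage_mono (hu.continuousOn_smul hP)
          (hPint.const_smul.add hPS.const_smul) fun z hz ↦ ?_
        rw [abs_one] at hz
        have hP0 : 0 ≤ poissonKernel 0 w z := poissonKernel_nonneg (by
          rw [mem_sphere_zero_iff_norm] at hz
          rw [mem_ball_zero_iff] at hw
          simp only [sub_zero]
          linarith)
        simp only [Pi.add_apply, Pi.smul_apply, smul_eq_mul]
        by_cases hz' : a < u z
        · rw [indicator_of_mem (by exact hz')]
          nlinarith [hb z hz]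
        · rw [indicator_of_notMem (by exact hz')]
          nlinarith
    _ = a + (b - a) * Real.circleAverage ({z | a < u z}.indicator (poissonKernel 0 w)) 0 1 := by
        rw [Real.circleAverage_add hPint.const_smul hPS.const_smul, Real.circleAverage_smul,
          Real.circleAverage_smul, hP1, smul_eq_mul, smul_eq_mul, mul_one]
    _ ≤ _ := by gcongr

theorem log_norm_le_of_norm_le_div_rpow {f : ℂ → ℂ} {C k : ℝ} (hC : 0 < C) (hk : 0 ≤ k)
    (hf : ∀ z ∈ ball (0 : ℂ) 1, ‖f z‖ ≤ C / (1 - ‖z‖) ^ k) {z : ℂ} (hz : z ∈ ball 0 1) :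
    Real.log ‖f z‖ ≤ k * |Real.log (1 - ‖z‖)| + |Real.log C| := by
  have hz1 : 0 < 1 - ‖z‖ := by
    rw [mem_ball_zero_iff] at hz
    linarith
  rcases eq_or_ne (f z) 0 with h0 | h0
  · rw [h0, norm_zero, Real.log_zero]
    positivity
  calc Real.log ‖f z‖ ≤ Real.log (C / (1 - ‖z‖) ^ k) :=
        Real.log_le_log (norm_pos_iff.2 h0) (hf z hz)
    _ = k * -Real.log (1 - ‖z‖) + Real.log C := by
        rw [Real.log_div hC.ne' (Real.rpow_pos_of_pos hz1 k).ne', Real.log_rpow hz1]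
        ring
    _ ≤ _ := by
        gcongr
        · exact neg_le_abs _
        · exact le_abs_self _

theorem tendsto_abs_log_one_sub_atTop :
    Tendsto (fun r : ℝ ↦ |Real.log (1 - r)|) (𝓝[<] 1) atTop := by
  refine tendsto_abs_atBot_atTop.comp (Real.tendsto_log_nhdsGT_zero.comp ?_)
  refine tendsto_nhdsWithin_iff.2 ⟨?_, ?_⟩
  · exact (Continuous.tendsto' (by fun_prop) 1 0 (by simp)).mono_left nhdsWithin_le_nhds
  · filter_upwards [self_mem_nhdsWithin] with r (hr : r < 1)
    exact sub_pos.2 hr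

theorem log_norm_mul_le_of_circleAverage_indicator_le {f : ℂ → ℂ} {C k c η r : ℝ} {w : ℂ}
    {E : Set ℝ} (hd : DifferentiableOn ℂ f (ball 0 1)) (hC : 0 < C) (hk : 0 ≤ k)
    (hf : ∀ z ∈ ball (0 : ℂ) 1, ‖f z‖ ≤ C / (1 - ‖z‖) ^ k) (hc : 0 ≤ c)
    (hr : r ∈ Ioo (0 : ℝ) 1) (hw : w ∈ ball 0 1) (hfw : f (r * w) ≠ 0)
    (hE : ∀ θ ∈ E, Real.log ‖f (circleMap 0 r θ)‖ ≤ -c * |Real.log (1 - r)|)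
    (hη : ∀ S : Set ℂ, MeasurableSet (circleMap 0 1 ⁻¹' S) → Disjoint E (circleMap 0 1 ⁻¹' S) →
      Real.circleAverage (S.indicator (poissonKernel 0 w)) 0 1 ≤ η) :
    Real.log ‖f (r * w)‖ ≤ -c * |Real.log (1 - r)|
      + ((k + c) * |Real.log (1 - r)| + |Real.log C|) * η := by
  obtain ⟨hr0, hr1⟩ := hr
  have hmaps : ∀ z ∈ closedBall (0 : ℂ) 1, r * z ∈ ball (0 : ℂ) 1 := fun z hz ↦ by
    rw [mem_closedBall_zero_iff] at hz
    rw [mem_ball_zero_iff, norm_mul, Complex.norm_real, Real.norm_of_nonneg hr0.le]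
    nlinarith
  have hcircle (θ : ℝ) : r * circleMap 0 1 θ = circleMap 0 r θ := by simp [circleMap]
  have hg : AnalyticOnNhd ℂ (fun z : ℂ ↦ f (r * z)) (closedBall 0 1) := fun z hz ↦
    (hd.analyticOnNhd isOpen_ball _ (hmaps z hz)).fun_comp (by fun_prop)
  have hmeas : Measurable fun θ : ℝ ↦ Real.log ‖f (r * circleMap 0 1 θ)‖ := by
    refine Real.measurable_log.comp (Continuous.measurable ?_)
    refine (hd.continuousOn.comp_continuous (by fun_prop) fun θ ↦ hmaps _ ?_).norm
    simp
  have hbound : ∀ z ∈ sphere (0 : ℂ) 1,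
      Real.log ‖f (r * z)‖ ≤ k * |Real.log (1 - r)| + |Real.log C| := fun z hz ↦ by
    have h := log_norm_le_of_norm_le_div_rpow hC hk hf (hmaps z (sphere_subset_closedBall hz))
    rwa [norm_mul, Complex.norm_real, Real.norm_of_nonneg hr0.le,
      mem_sphere_zero_iff_norm.1 hz, mul_one] at h
  have hL := abs_nonneg (Real.log (1 - r))
  set L := |Real.log (1 - r)|
  have hS : MeasurableSet (circleMap 0 1 ⁻¹' {z | -c * L < Real.log ‖f (r * z)‖}) :=
    hmeas measurableSet_Ioi
  calc _ ≤ Real.circleAverage (fun z ↦ poissonKernel 0 w z * Real.log ‖f (r * z)‖) 0 1 :=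
        log_norm_le_circleAverage_poissonKernel hg hw hfw
    _ ≤ -c * L + ((k * L + |Real.log C|) - -c * L) * η := by
        refine circleAverage_poissonKernel_mul_le hw ?_ hS ?_ hbound (hη _ hS ?_)
        · refine MeromorphicOn.circleIntegrable_log_norm fun z hz ↦ (hg z ?_).meromorphicAt
          rw [abs_one] at hz
          exact sphere_subset_closedBall hz
        · nlinarith [abs_nonneg (Real.log C), mul_nonneg hk hL, mul_nonneg hc hL]
        · refine disjoint_left.2 fun θ hθ h ↦ ?_
          rw [mem_preimage, mem_ofPred_eq, hcircle] at h
          exact h.not_ge (hE θ hθ)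
    _ = _ := by ring

theorem Korenblum.not_tendsto_density {f : ℂ → ℂ} (hf : Korenblum f) {E : Set ℝ} {θ c : ℝ}
    (hc : 0 < c) (hθ : θ ∈ E)
    (hE : ∀ᶠ r in 𝓝[<] 1, ∀ x ∈ E,
      Real.log ‖f (circleMap 0 r x)‖ ≤ -c * |Real.log (1 - r)|) :
    ¬ Tendsto (fun t ↦ volume (E ∩ closedBall θ t) / volume (closedBall θ t)) (𝓝[>] 0) (𝓝 1) := by
  intro hdens
  obtain ⟨hd, C, k, hC, hk, hfb⟩ := hf
  have hη : 0 < c / (2 * (k + c)) := by positivity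
  have hsub : Tendsto (fun s : ℝ ↦ 1 - s) (𝓝[>] 0) (𝓝[<] 1) := by
    refine tendsto_nhdsWithin_iff.2 ⟨?_, ?_⟩
    · exact (Continuous.tendsto' (by fun_prop) 0 1 (by simp)).mono_left nhdsWithin_le_nhds
    · filter_upwards [self_mem_nhdsWithin] with s (hs : 0 < s)
      exact sub_lt_self 1 hs
  obtain ⟨s, hs, hsE, hsL, hs0, hs1⟩ :=
    ((eventually_circleAverage_indicator_poissonKernel_le hdens hη).and
      ((hsub.eventually hE).and ((hsub.eventually
        (tendsto_abs_log_one_sub_atTop.eventually_gt_atTop 0)).and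
        (Ioo_mem_nhdsGT one_pos)))).exists
  set w := circleMap 0 (1 - s) θ
  have hw : w ∈ ball (0 : ℂ) 1 := by
    rw [mem_ball_zero_iff, norm_circleMap_zero, abs_of_pos (by linarith)]
    linarith
  have hfw : f w ≠ 0 := fun h ↦ by
    have h1 := hsE θ hθ
    rw [h, norm_zero, Real.log_zero] at h1
    nlinarith
  have hlim : Tendsto (fun r : ℝ ↦ f (r * w)) (𝓝[<] 1) (𝓝 (f w)) := by
    have h1 : Tendsto (fun r : ℝ ↦ (r : ℂ) * w) (𝓝 1) (𝓝 w) :=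
      Continuous.tendsto' (by fun_prop) _ _ (by simp)
    exact (hd.continuousOn.continuousAt (isOpen_ball.mem_nhds hw)).tendsto.comp
      (h1.mono_left nhdsWithin_le_nhds)
  have hlog := hlim.norm.log (norm_ne_zero_iff.2 hfw)
  have hle : ∀ᶠ r in 𝓝[<] 1, c / 2 * |Real.log (1 - r)|
      ≤ |Real.log C| * (c / (2 * (k + c))) - Real.log ‖f (r * w)‖ := by
    filter_upwards [hE, hlim.eventually_ne hfw, Ioo_mem_nhdsLT one_pos] with r hrE hr0 hr
    have h := log_norm_mul_le_of_circleAverage_indicator_le hd hC hk.le hfb hc.le hr hw hr0 hrE hs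
    have h2 : (k + c) * |Real.log (1 - r)| * (c / (2 * (k + c))) = c / 2 * |Real.log (1 - r)| := by
      field_simp
    linarith
  exact not_tendsto_nhds_of_tendsto_atTop
    (tendsto_atTop_mono' _ hle (tendsto_abs_log_one_sub_atTop.const_mul_atTop (half_pos hc)))
    _ (hlog.const_sub _)

theorem Korenblum.volume_eq_zero {f : ℂ → ℂ} (hf : Korenblum f) {E : Set ℝ} {c : ℝ} (hc : 0 < c)
    (hE : ∀ᶠ r in 𝓝[<] 1, ∀ x ∈ E,
      Real.log ‖f (circleMap 0 r x)‖ ≤ -c * |Real.log (1 - r)|) :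
    volume E = 0 := by
  have h := ae_imp_of_ae_restrict (Besicovitch.ae_tendsto_measure_inter_div volume E)
  refine measure_mono_null (fun θ hθ ↦ ?_) h
  exact fun h ↦ hf.not_tendsto_density hc hθ hE (h hθ)

end

/-- For every `f ∈ A^{-∞}`, the set `D_-(f)` has Lebesgue measure zero. -/
theorem stmt13 (f : ℂ → ℂ) (hf : Korenblum f) : volume (Dminus f) = 0 := by
  have hpos (n : ℕ) : (0 : ℝ) < 1 / (n + 1) := by positivity
  have hsub : Dminus f ⊆ ⋃ n : ℕ, {θ : ℝ | ∀ r ∈ Set.Ioo (1 - 1 / ((n : ℝ) + 1)) 1,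
      Real.log ‖f (circleMap 0 r θ)‖ ≤ -(1 / ((n : ℝ) + 1)) * |Real.log (1 - r)|} := by
    rintro θ ⟨-, c, hc, hθ⟩
    obtain ⟨a, ha, hθ⟩ := mem_nhdsLT_iff_exists_Ioo_subset.1
      (hθ.and (tendsto_abs_log_one_sub_atTop.eventually_gt_atTop 0))
    obtain ⟨n, hn⟩ := exists_nat_one_div_lt (lt_min hc (sub_pos.2 ha))
    refine Set.mem_iUnion.2 ⟨n, fun r hr ↦ ?_⟩
    obtain ⟨h, hL⟩ := hθ ⟨by linarith [min_le_right c (1 - a), hr.1], hr.2⟩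
    rw [div_le_iff₀ hL, mul_comm Complex.I] at h
    rw [circleMap_zero]
    refine h.trans ?_
    gcongr
    exact hn.le.trans (min_le_left _ _)
  refine measure_mono_null hsub (measure_iUnion_null fun n ↦ hf.volume_eq_zero (hpos n) ?_)
  filter_upwards [Ioo_mem_nhdsLT (sub_lt_self 1 (hpos n))] with r hr θ hθ
  exact hθ r hr
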